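/- Suppose Condition 4.1 holds with parameter θ₁. Then for every j = 1,…,d and every μ ∈ [0, θ₁): sup_{s ∈ [0,1]} | G_{nj}(G_{nj}^−(s)) − s | = o_P(n^{−1/2−μ}) as n → ∞. -/

import Mathlib

open MeasureTheory Filter Set
open scoped ENNReal NNReal

noncomputable section

namespace BBV

variable {Ω : Type*} [MeasurableSpace Ω] {E : Type*} [MeasurableSpace E] {d : ℕ}

/-- The real-valued indicator function of a set. -/
def indic {α : Type*} (s : Set α) (x : α) : ℝ := s.indicator (fun _ => (1 : ℝ)) x

/-- `Z n = o_P(r n)`: convergence to zero in (outer) probability at rate `r`. -/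
def oP (P : Measure Ω) (Z : ℕ → Ω → ℝ) (r : ℕ → ℝ) : Prop :=
  ∀ ε : ℝ, 0 < ε → Tendsto (fun n => P {ω | ε * r n < |Z n ω|}) atTop (nhds 0)

/-- `Z n = o_P(1)`: convergence to zero in (outer) probability. -/
def oP1 (P : Measure Ω) (Z : ℕ → Ω → ℝ) : Prop := oP P Z fun _ => 1

/-- `Z n = O_P(1)`: boundedness in (outer) probability. -/
def bigOP (P : Measure Ω) (Z : ℕ → Ω → ℝ) : Prop :=
  ∀ ε : ℝ, 0 < ε → ∃ M : ℝ, ∀ᶠ n in atTop, P {ω | M < |Z n ω|} ≤ ENNReal.ofReal ε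

/-- Strict stationarity of a two-sided sequence: all finite-dimensional distributions
are invariant under shifts. -/
def StrictlyStationary (P : Measure Ω) (X : ℤ → Ω → E) : Prop :=
  ∀ (m : ℕ) (idx : Fin m → ℤ) (k : ℤ),
    Measure.map (fun ω (p : Fin m) => X (idx p + k) ω) P =
      Measure.map (fun ω (p : Fin m) => X (idx p) ω) P

/-- The sigma-field generated by the variables `X i`, `i ∈ S`. -/
def mixSigma (X : ℤ → Ω → E) (S : Set ℤ) : MeasurableSpace Ω :=
  ⨆ i ∈ S, MeasurableSpace.comap (X i) inferInstance

/-- The alpha-mixing coefficient of the sequence `X`. -/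
def alphaMix (P : Measure Ω) (X : ℤ → Ω → E) (k : ℕ) : ℝ :=
  sSup {r : ℝ | ∃ (i : ℤ) (A B : Set Ω),
    MeasurableSet[mixSigma X (Set.Iic i)] A ∧
    MeasurableSet[mixSigma X (Set.Ici (i + (k : ℤ)))] B ∧
    r = |(P (A ∩ B)).toReal - (P A).toReal * (P B).toReal|}

/-- Exponentially decaying alpha-mixing coefficients: `α(k) = O(a^k)` for some `a ∈ (0,1)`. -/
def ExpAlphaMixing (P : Measure Ω) (X : ℤ → Ω → E) : Prop :=
  ∃ a ∈ Set.Ioo (0 : ℝ) 1, ∃ c : ℝ, ∀ k : ℕ, 1 ≤ k → alphaMix P X k ≤ c * a ^ k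

/-- Marginal c.d.f. `F_j` of the stationary sequence. -/
def margF (P : Measure Ω) (X : ℤ → Ω → Fin d → ℝ) (j : Fin d) (x : ℝ) : ℝ :=
  (P {ω | X 0 ω j ≤ x}).toReal

/-- `U_i = (F_1(X_{i1}),…,F_d(X_{id}))`. -/
def Uv (P : Measure Ω) (X : ℤ → Ω → Fin d → ℝ) (i : ℤ) (ω : Ω) (j : Fin d) : ℝ :=
  margF P X j (X i ω j)

/-- The copula `C` of the stationary distribution, i.e. the c.d.f. of `U_0`. -/
def cop (P : Measure Ω) (X : ℤ → Ω → Fin d → ℝ) (u : Fin d → ℝ) : ℝ :=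
  (P {ω | ∀ j, Uv P X 0 ω j ≤ u j}).toReal

/-- Empirical c.d.f. `G_n` of the (unobservable) sample `U_1,…,U_n`. -/
def Gn (P : Measure Ω) (X : ℤ → Ω → Fin d → ℝ) (n : ℕ) (u : Fin d → ℝ) (ω : Ω) : ℝ :=
  (n : ℝ)⁻¹ * ∑ i ∈ Finset.Icc (1 : ℤ) (n : ℤ), indic {ω' | ∀ j, Uv P X i ω' j ≤ u j} ω

/-- The empirical process `α_n = √n (G_n − C)`. -/
def alphan (P : Measure Ω) (X : ℤ → Ω → Fin d → ℝ) (n : ℕ) (u : Fin d → ℝ) (ω : Ω) : ℝ :=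
  Real.sqrt n * (Gn P X n u ω - cop P X u)

/-- Marginal empirical c.d.f. `G_{nj}` based on `U_{1j},…,U_{nj}`. -/
def Gnj (P : Measure Ω) (X : ℤ → Ω → Fin d → ℝ) (n : ℕ) (j : Fin d) (s : ℝ) (ω : Ω) : ℝ :=
  (n : ℝ)⁻¹ * ∑ i ∈ Finset.Icc (1 : ℤ) (n : ℤ), indic {ω' | Uv P X i ω' j ≤ s} ω

/-- The marginal empirical process `α_{nj}(s) = √n (G_{nj}(s) − s)`. -/
def alphanj (P : Measure Ω) (X : ℤ → Ω → Fin d → ℝ) (n : ℕ) (j : Fin d) (s : ℝ) (ω : Ω) : ℝ :=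
  Real.sqrt n * (Gnj P X n j s ω - s)

/-- Left-continuous generalized inverse: `H⁻(s) = inf{x : H(x) ≥ s}` for `s ≠ 0`,
and `H⁻(0) = sup{x : H(x) = 0}`. -/
def genInv (H : ℝ → ℝ) (s : ℝ) : ℝ :=
  if s = 0 then sSup {x | H x = 0} else sInf {x | s ≤ H x}

/-- The marginal quantile process `β_{nj}(s) = √n (G_{nj}⁻(s) − s)`. -/
def betanj (P : Measure Ω) (X : ℤ → Ω → Fin d → ℝ) (n : ℕ) (j : Fin d) (s : ℝ) (ω : Ω) : ℝ :=
  Real.sqrt n * (genInv (fun x => Gnj P X n j x ω) s - s)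

/-- Marginal empirical c.d.f. `F_{nj}` of the observations `X_{1j},…,X_{nj}`. -/
def empCdfX (X : ℤ → Ω → Fin d → ℝ) (n : ℕ) (j : Fin d) (x : ℝ) (ω : Ω) : ℝ :=
  (n : ℝ)⁻¹ * ∑ i ∈ Finset.Icc (1 : ℤ) (n : ℤ), indic {ω' | X i ω' j ≤ x} ω

/-- Pseudo-observations `Û_{ij} = n/(n+1) · F_{nj}(X_{ij})`. -/
def pseudoObs (X : ℤ → Ω → Fin d → ℝ) (n : ℕ) (i : ℤ) (ω : Ω) (j : Fin d) : ℝ :=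
  (n : ℝ) / ((n : ℝ) + 1) * empCdfX X n j (X i ω j) ω

/-- The empirical copula `Ĉ_n`. -/
def empCop (X : ℤ → Ω → Fin d → ℝ) (n : ℕ) (u : Fin d → ℝ) (ω : Ω) : ℝ :=
  (n : ℝ)⁻¹ * ∑ i ∈ Finset.Icc (1 : ℤ) (n : ℤ), indic {ω' | ∀ j, pseudoObs X n i ω' j ≤ u j} ω

/-- The empirical copula process `ĈP_n = √n (Ĉ_n − C)`. -/
def hatCP (P : Measure Ω) (X : ℤ → Ω → Fin d → ℝ) (n : ℕ) (u : Fin d → ℝ) (ω : Ω) : ℝ :=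
  Real.sqrt n * (empCop X n u ω - cop P X u)

/-- First-order partial derivative `Ċ_j` of `C`, defined everywhere as the limsup of
difference quotients (which coincides with the partial derivative wherever it exists). -/
def Cdot (C : (Fin d → ℝ) → ℝ) (j : Fin d) (u : Fin d → ℝ) : ℝ :=
  Filter.limsup (fun h : ℝ => (C (Function.update u j (u j + h)) - C u) / h)
    (nhdsWithin 0 {(0 : ℝ)}ᶜ)

/-- The process `C̄_n(u) = α_n(u) − Σ_j Ċ_j(u) α_n(u^{(j)})`. -/
def Cbar (P : Measure Ω) (X : ℤ → Ω → Fin d → ℝ) (n : ℕ) (u : Fin d → ℝ) (ω : Ω) : ℝ :=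
  alphan P X n u ω -
    ∑ j, Cdot (cop P X) j u * alphan P X n (Function.update (fun _ => (1 : ℝ)) j (u j)) ω

/-- `C_n(u) = G_n(G_{n1}⁻(u₁),…,G_{nd}⁻(u_d))`. -/
def copGI (P : Measure Ω) (X : ℤ → Ω → Fin d → ℝ) (n : ℕ) (u : Fin d → ℝ) (ω : Ω) : ℝ :=
  Gn P X n (fun j => genInv (fun x => Gnj P X n j x ω) (u j)) ω

/-- The empirical copula process `𝔺_n = √n (C_n − C)` based on generalized inverses. -/
def CPgi (P : Measure Ω) (X : ℤ → Ω → Fin d → ℝ) (n : ℕ) (u : Fin d → ℝ) (ω : Ω) : ℝ :=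
  Real.sqrt n * (copGI P X n u ω - cop P X u)

/-- `g₁(u) = min{ min_j u_j , min_j [1 − min_{k ≠ j} u_k] }`. -/
def g1 (u : Fin d → ℝ) : ℝ :=
  min (⨅ j, u j) (⨅ j : Fin d, (1 - ⨅ k : {k : Fin d // k ≠ j}, u (k : Fin d)))

/-- The weight function `g_ω(u) = g₁(u)^ω`. -/
def gW (w : ℝ) (u : Fin d → ℝ) : ℝ := g1 u ^ w

/-- `g̃_ω(u) = g_ω(u) + 1{g_ω(u) = 0}`. -/
def gTilde (w : ℝ) (u : Fin d → ℝ) : ℝ := if gW w u = 0 then 1 else gW w u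

/-- `N(a,b) = {u ∈ [0,1]^d : a < g₁(u) ≤ b}`. -/
def NN (d : ℕ) (a b : ℝ) : Set (Fin d → ℝ) :=
  {u | (∀ j, 0 ≤ u j ∧ u j ≤ 1) ∧ a < g1 u ∧ g1 u ≤ b}

/-- `V_j = {u ∈ [0,1]^d : u_j ∈ (0,1)}`. -/
def VV (d : ℕ) (j : Fin d) : Set (Fin d → ℝ) :=
  {u | (∀ k, 0 ≤ u k ∧ u k ≤ 1) ∧ 0 < u j ∧ u j < 1}

/-- Condition 2.1: existence, continuity and growth bounds for the first and second
order partial derivatives of the copula `C`. -/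
def Condition21 (C : (Fin d → ℝ) → ℝ) : Prop :=
  (∀ j : Fin d, ∀ u ∈ VV d j,
    HasDerivAt (fun t => C (Function.update u j t)) (Cdot C j u) (u j)) ∧
  (∀ j : Fin d, ContinuousOn (Cdot C j) (VV d j)) ∧
  ∃ Cdd : Fin d → Fin d → (Fin d → ℝ) → ℝ,
    (∀ j₁ j₂ : Fin d, ∀ u ∈ VV d j₁ ∩ VV d j₂,
      HasDerivAt (fun t => Cdot C j₂ (Function.update u j₁ t)) (Cdd j₁ j₂ u) (u j₁)) ∧
    (∀ j₁ j₂ : Fin d, ContinuousOn (Cdd j₁ j₂) (VV d j₁ ∩ VV d j₂)) ∧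
    ∃ K : ℝ, 0 < K ∧ ∀ j₁ j₂ : Fin d, ∀ u ∈ VV d j₁ ∩ VV d j₂,
      |Cdd j₁ j₂ u| ≤ K * min (1 / (u j₁ * (1 - u j₁))) (1 / (u j₂ * (1 - u j₂)))

/-- The weighted modulus of continuity `M_n(δ,μ)` of the empirical process. -/
def Mn (P : Measure Ω) (X : ℤ → Ω → Fin d → ℝ) (n : ℕ) (δ μ : ℝ) (ω : Ω) : ℝ :=
  ⨆ q ∈ {q : (Fin d → ℝ) × (Fin d → ℝ) |
      q.1 ∈ Set.Icc 0 1 ∧ q.2 ∈ Set.Icc 0 1 ∧ dist q.1 q.2 ≤ δ},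
    |alphan P X n q.1 ω - alphan P X n q.2 ω| / max (dist q.1 q.2 ^ μ) ((n : ℝ) ^ (-μ))

/-- Condition 4.1 with parameter `θ₁`. -/
def Condition41 (P : Measure Ω) (X : ℤ → Ω → Fin d → ℝ) (θ₁ : ℝ) : Prop :=
  ∀ μ ∈ Set.Ioo (0 : ℝ) θ₁, ∀ δ : ℕ → ℝ, Tendsto δ atTop (nhds 0) →
    oP1 P (fun n ω => Mn P X n (δ n) μ ω)

/-- Condition 4.3 with parameters `θ₂, θ₃`. -/
def Condition43 (P : Measure Ω) (X : ℤ → Ω → Fin d → ℝ) (θ₂ θ₃ : ℝ) : Prop :=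
  ∀ w ∈ Set.Ioo (0 : ℝ) θ₂, ∀ lam ∈ Set.Ioo (0 : ℝ) θ₃, ∀ j : Fin d,
    bigOP P (fun n ω => ⨆ s ∈ Set.Ioo (0 : ℝ) 1,
      |alphanj P X n j s ω| / (s * (1 - s)) ^ w) ∧
    bigOP P (fun n ω => ⨆ s ∈ Set.Ioo ((n : ℝ) ^ (-lam)) (1 - (n : ℝ) ^ (-lam)),
      |betanj P X n j s ω| / (s * (1 - s)) ^ w)

/-- If the increments of a distribution function on `[0,1]` over short intervals exceed the length
of the interval by at most `B`, then composing it with its generalized inverse gives the identity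
up to an error of at most `B`. -/
lemma abs_comp_genInv_sub_le {G : ℝ → ℝ} (hG : Monotone G) (h0 : G 0 = 0) (h1 : G 1 = 1)
    {c B : ℝ} (hc : 0 < c)
    (hB : ∀ x y, 0 ≤ x → x ≤ y → y ≤ 1 → y - x ≤ c → G y - G x ≤ B + (y - x))
    {s : ℝ} (hs : s ∈ Icc (0 : ℝ) 1) : |G (genInv G s) - s| ≤ B := by
  have hB0 : 0 ≤ B := by simpa using hB 0 0 le_rfl le_rfl zero_le_one (by simpa using hc.le)
  rcases eq_or_lt_of_le hs.1 with rfl | hspos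
  · have hbdd : ∀ x ∈ {x | G x = 0}, x ≤ 1 := fun x (hx : G x = 0) => by
      by_contra! h
      linarith [hG h.le]
    have hmem : (0 : ℝ) ∈ {x | G x = 0} := h0
    simp only [genInv, if_true]
    set a := sSup {x | G x = 0}
    have ha0 : 0 ≤ a := le_csSup ⟨1, hbdd⟩ hmem
    have ha1 : a ≤ 1 := csSup_le ⟨0, hmem⟩ hbdd
    have hGa : 0 ≤ G a := h0 ▸ hG ha0
    rw [sub_zero, abs_of_nonneg hGa]
    refine le_of_forall_pos_le_add fun ε hε => ?_
    obtain ⟨y, hy : G y = 0, hya⟩ := exists_lt_of_lt_csSup ⟨0, hmem⟩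
      (show a - min c ε < a by linarith [lt_min hc hε])
    have hya' : y ≤ a := le_csSup ⟨1, hbdd⟩ hy
    have hm : G (max y 0) = 0 := by
      rcases max_choice y 0 with h | h <;> rw [h] <;> assumption
    have := hB (max y 0) a (le_max_right _ _) (max_le hya' ha0) ha1
      (by linarith [le_max_left y 0, min_le_left c ε])
    linarith [le_max_left y 0, min_le_right c ε]
  · have hbdd : ∀ x ∈ {x | s ≤ G x}, 0 ≤ x := fun x (hx : s ≤ G x) => by
      by_contra! h
      linarith [hG h.le]
    have hmem : (1 : ℝ) ∈ {x | s ≤ G x} := by simpa [h1] using hs.2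
    simp only [genInv, if_neg hspos.ne']
    set a := sInf {x | s ≤ G x}
    have ha0 : 0 ≤ a := le_csInf ⟨1, hmem⟩ hbdd
    have ha1 : a ≤ 1 := csInf_le ⟨0, hbdd⟩ hmem
    rw [abs_sub_le_iff]
    constructor
    · rcases eq_or_lt_of_le ha0 with h | hapos
      · rw [← h, h0]
        linarith
      refine le_of_forall_pos_le_add fun ε hε => ?_
      set y := max (a - min c ε) 0
      have hya : y < a := max_lt (by linarith [lt_min hc hε]) hapos
      have hGy : G y < s := by
        by_contra! h
        exact absurd (csInf_le ⟨0, hbdd⟩ h) (not_le.2 hya)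
      have hy' : a - min c ε ≤ y := le_max_left _ _
      have := hB y a (le_max_right _ _) hya.le ha1 (by linarith [min_le_left c ε])
      linarith [min_le_right c ε]
    · refine le_of_forall_pos_le_add fun ε hε => ?_
      obtain ⟨y, hy : s ≤ G y, hya⟩ := exists_lt_of_csInf_lt ⟨1, hmem⟩
        (show a < a + min c ε by linarith [lt_min hc hε])
      have hay : a ≤ y := csInf_le ⟨0, hbdd⟩ hy
      have hm : s ≤ G (min y 1) := by
        rcases min_choice y 1 with h | h <;> rw [h] <;> assumption
      have := hB a (min y 1) ha0 (le_min hay ha1) (min_le_right _ _)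
        (by linarith [min_le_left y 1, min_le_left c ε])
      linarith [min_le_left y 1, min_le_right c ε]

lemma margF_eq_cdf (P : Measure Ω) [IsProbabilityMeasure P] {X : ℤ → Ω → Fin d → ℝ}
    (hX : Measurable (X 0)) (j : Fin d) :
    margF P X j = ProbabilityTheory.cdf (P.map fun ω => X 0 ω j) := by
  have hXj : Measurable fun ω => X 0 ω j := (measurable_pi_apply j).comp hX
  have := Measure.isProbabilityMeasure_map (μ := P) hXj.aemeasurable
  ext x
  rw [ProbabilityTheory.cdf_eq_real, measureReal_def, Measure.map_apply hXj measurableSet_Iic]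
  rfl

/-- The probability integral transform. -/
lemma measure_Uv_le (P : Measure Ω) [IsProbabilityMeasure P] {X : ℤ → Ω → Fin d → ℝ}
    (hX : Measurable (X 0)) {j : Fin d} (hcont : Continuous (margF P X j))
    {t : ℝ} (ht : t ∈ Icc (0 : ℝ) 1) : (P {ω | Uv P X 0 ω j ≤ t}).toReal = t := by
  have hF := margF_eq_cdf P hX j
  have hmono : Monotone (margF P X j) := hF ▸ ProbabilityTheory.monotone_cdf _
  have hbot : Tendsto (margF P X j) atBot (nhds 0) := hF ▸ ProbabilityTheory.tendsto_cdf_atBot _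
  have htop : Tendsto (margF P X j) atTop (nhds 1) := hF ▸ ProbabilityTheory.tendsto_cdf_atTop _
  have hivt : ∀ r ∈ Ioo (0 : ℝ) 1, ∃ a, margF P X j a = r := fun r hr =>
    mem_range_of_exists_le_of_exists_ge hcont
      ((hbot.eventually_le_const hr.1).exists) ((htop.eventually_const_le hr.2).exists)
  have hle1 : ∀ s : Set Ω, (P s).toReal ≤ 1 := fun s => measureReal_le_one
  apply le_antisymm
  · refine le_of_forall_gt_imp_ge_of_dense fun r hr => ?_
    rcases le_or_gt 1 r with h | h
    · exact (hle1 _).trans h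
    obtain ⟨a, ha⟩ := hivt r ⟨ht.1.trans_lt hr, h⟩
    rw [← ha]
    refine measureReal_mono fun ω (hω : margF P X j (X 0 ω j) ≤ t) => ?_
    by_contra hlt
    linarith [hmono (not_le.1 hlt).le]
  · refine le_of_forall_lt_imp_le_of_dense fun r hr => ?_
    rcases le_or_gt r 0 with h | h
    · exact h.trans ENNReal.toReal_nonneg
    obtain ⟨a, ha⟩ := hivt r ⟨h, hr.trans_le ht.2⟩
    rw [← ha]
    refine measureReal_mono fun ω (hω : X 0 ω j ≤ a) => ?_
    exact (hmono hω).trans (ha.trans_le hr.le)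

lemma Uv_le_one (P : Measure Ω) [IsProbabilityMeasure P] (X : ℤ → Ω → Fin d → ℝ)
    (i : ℤ) (ω : Ω) (j : Fin d) : Uv P X i ω j ≤ 1 :=
  measureReal_le_one

lemma forall_Uv_le_update_iff (P : Measure Ω) [IsProbabilityMeasure P] (X : ℤ → Ω → Fin d → ℝ)
    (i : ℤ) (ω : Ω) (j : Fin d) (x : ℝ) :
    (∀ k, Uv P X i ω k ≤ Function.update (1 : Fin d → ℝ) j x k) ↔ Uv P X i ω j ≤ x := by
  rw [Function.forall_update_iff (p := fun k y => Uv P X i ω k ≤ y)]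
  exact and_iff_left fun k _ => Uv_le_one P X i ω k

lemma alphan_update (P : Measure Ω) [IsProbabilityMeasure P] {X : ℤ → Ω → Fin d → ℝ}
    (hX : Measurable (X 0)) {j : Fin d} (hcont : Continuous (margF P X j))
    (n : ℕ) (ω : Ω) {x : ℝ} (hx : x ∈ Icc (0 : ℝ) 1) :
    alphan P X n (Function.update 1 j x) ω = alphanj P X n j x ω := by
  simp only [alphan, alphanj, Gn, Gnj, cop, forall_Uv_le_update_iff, measure_Uv_le P hX hcont hx]

lemma sum_indic_mem_Icc {α : Type*} (A : ℤ → Set α) (n : ℕ) (ω : α) :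
    (n : ℝ)⁻¹ * ∑ i ∈ Finset.Icc (1 : ℤ) (n : ℤ), indic (A i) ω ∈ Icc (0 : ℝ) 1 := by
  have hi : ∀ i, indic (A i) ω ∈ Icc (0 : ℝ) 1 := fun i => by
    by_cases h : ω ∈ A i <;> simp [indic, h]
  refine ⟨mul_nonneg (by positivity) (Finset.sum_nonneg fun i _ => (hi i).1), ?_⟩
  have := Finset.sum_le_card_nsmul (Finset.Icc (1 : ℤ) (n : ℤ)) _ 1 fun i _ => (hi i).2
  simp only [Int.card_Icc, add_sub_cancel_right, Int.toNat_natCast, nsmul_eq_mul, mul_one] at this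
  exact (mul_le_mul_of_nonneg_left this (by positivity)).trans inv_mul_le_one

lemma abs_alphan_le (P : Measure Ω) [IsProbabilityMeasure P] (X : ℤ → Ω → Fin d → ℝ)
    (n : ℕ) (u : Fin d → ℝ) (ω : Ω) : |alphan P X n u ω| ≤ Real.sqrt n := by
  have hG : Gn P X n u ω ∈ Icc (0 : ℝ) 1 := sum_indic_mem_Icc _ n ω
  have hC1 : cop P X u ≤ 1 := measureReal_le_one
  have hC0 : 0 ≤ cop P X u := ENNReal.toReal_nonneg
  rw [alphan, abs_mul, abs_of_nonneg (Real.sqrt_nonneg _)]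
  refine mul_le_of_le_one_right (Real.sqrt_nonneg _) (abs_le.2 ⟨?_, ?_⟩) <;> linarith [hG.1, hG.2]

lemma div_le_Mn (P : Measure Ω) [IsProbabilityMeasure P] (X : ℤ → Ω → Fin d → ℝ)
    {n : ℕ} (hn : 0 < n) (δ μ : ℝ) (ω : Ω) {u v : Fin d → ℝ} (hu : u ∈ Icc 0 1)
    (hv : v ∈ Icc 0 1) (huv : dist u v ≤ δ) :
    |alphan P X n u ω - alphan P X n v ω| / max (dist u v ^ μ) ((n : ℝ) ^ (-μ))
      ≤ Mn P X n δ μ ω := by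
  have hnpos : 0 < (n : ℝ) ^ (-μ) := Real.rpow_pos_of_pos (Nat.cast_pos.2 hn) _
  have hbound : ∀ q : (Fin d → ℝ) × (Fin d → ℝ),
      |alphan P X n q.1 ω - alphan P X n q.2 ω| / max (dist q.1 q.2 ^ μ) ((n : ℝ) ^ (-μ))
        ≤ (2 * Real.sqrt n) / (n : ℝ) ^ (-μ) := fun q => by
    refine div_le_div₀ (by positivity) ?_ hnpos (le_max_right _ _)
    have := abs_sub (alphan P X n q.1 ω) (alphan P X n q.2 ω)
    linarith [abs_alphan_le P X n q.1 ω, abs_alphan_le P X n q.2 ω]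
  have hbdd : BddAbove (range fun q : (Fin d → ℝ) × (Fin d → ℝ) =>
      ⨆ _ : q ∈ {q : (Fin d → ℝ) × (Fin d → ℝ) |
        q.1 ∈ Set.Icc 0 1 ∧ q.2 ∈ Set.Icc 0 1 ∧ dist q.1 q.2 ≤ δ},
      |alphan P X n q.1 ω - alphan P X n q.2 ω| / max (dist q.1 q.2 ^ μ) ((n : ℝ) ^ (-μ))) := by
    refine ⟨(2 * Real.sqrt n) / (n : ℝ) ^ (-μ), ?_⟩
    rintro _ ⟨q, rfl⟩
    exact Real.iSup_le (fun _ => hbound q) (by positivity)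
  refine le_trans ?_ (le_ciSup hbdd (u, v))
  rw [ciSup_pos ⟨hu, hv, huv⟩]

lemma update_one_mem_Icc (j : Fin d) {x : ℝ} (hx : x ∈ Icc (0 : ℝ) 1) :
    Function.update (1 : Fin d → ℝ) j x ∈ Icc (0 : Fin d → ℝ) 1 := by
  constructor <;> intro k <;> by_cases h : k = j
  · subst h; simpa using hx.1
  · simp [h]
  · subst h; simpa using hx.2
  · simp [h]

lemma dist_update_update (j : Fin d) (u : Fin d → ℝ) (x y : ℝ) :
    dist (Function.update u j x) (Function.update u j y) = dist x y := by
  apply le_antisymm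
  · refine (dist_pi_le_iff dist_nonneg).2 fun k => ?_
    by_cases h : k = j
    · subst h; simp
    · simp [h]
  · simpa using dist_le_pi_dist (Function.update u j x) (Function.update u j y) j

lemma monotone_Gnj (P : Measure Ω) (X : ℤ → Ω → Fin d → ℝ) (n : ℕ) (j : Fin d) (ω : Ω) :
    Monotone fun x => Gnj P X n j x ω := fun x y hxy => by
  refine mul_le_mul_of_nonneg_left (Finset.sum_le_sum fun i _ => ?_) (by positivity)
  exact indicator_le_indicator_of_subset (fun ω' (h : Uv P X i ω' j ≤ x) => h.trans hxy)
    (fun _ => zero_le_one) ω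

lemma Gnj_one (P : Measure Ω) [IsProbabilityMeasure P] (X : ℤ → Ω → Fin d → ℝ)
    {n : ℕ} (hn : 0 < n) (j : Fin d) (ω : Ω) : Gnj P X n j 1 ω = 1 := by
  have : (n : ℝ) ≠ 0 := by positivity
  simp [Gnj, indic, Uv_le_one, this]

lemma Gnj_sub_le (P : Measure Ω) [IsProbabilityMeasure P] {X : ℤ → Ω → Fin d → ℝ}
    (hX : Measurable (X 0)) {j : Fin d} (hcont : Continuous (margF P X j))
    {n : ℕ} (hn : 0 < n) {μ : ℝ} (hμ : 0 ≤ μ) (ω : Ω) {x y : ℝ} (hx : 0 ≤ x) (hxy : x ≤ y)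
    (hy : y ≤ 1) (hle : y - x ≤ (n : ℝ)⁻¹) :
    Gnj P X n j y ω - Gnj P X n j x ω
      ≤ Mn P X n (n : ℝ)⁻¹ μ ω * (n : ℝ) ^ (-(1/2 : ℝ) - μ) + (y - x) := by
  have hn0 : (0 : ℝ) < n := Nat.cast_pos.2 hn
  have hnpos : 0 < (n : ℝ) ^ (-μ) := Real.rpow_pos_of_pos hn0 _
  have hxm : x ∈ Icc (0 : ℝ) 1 := ⟨hx, hxy.trans hy⟩
  have hym : y ∈ Icc (0 : ℝ) 1 := ⟨hx.trans hxy, hy⟩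
  have hdist : dist y x = y - x := by rw [Real.dist_eq, abs_of_nonneg (by linarith)]
  have h := div_le_Mn P X hn (n : ℝ)⁻¹ μ ω (update_one_mem_Icc j hym) (update_one_mem_Icc j hxm)
    (by rw [dist_update_update, hdist]; exact hle)
  rw [dist_update_update, hdist, alphan_update P hX hcont n ω hym,
    alphan_update P hX hcont n ω hxm, max_eq_right, div_le_iff₀ hnpos] at h
  · have h2 := (le_abs_self _).trans h
    have hsq : (n : ℝ) ^ (-(1/2 : ℝ)) * Real.sqrt n = 1 := by
      rw [Real.sqrt_eq_rpow, ← Real.rpow_add hn0]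
      simp
    have h3 := mul_le_mul_of_nonneg_left h2 (Real.rpow_nonneg hn0.le (-(1/2 : ℝ)))
    rw [sub_eq_add_neg (-(1/2 : ℝ)) μ, Real.rpow_add hn0]
    have h4 : (n : ℝ) ^ (-(1/2 : ℝ)) * (alphanj P X n j y ω - alphanj P X n j x ω)
        = (Gnj P X n j y ω - y) - (Gnj P X n j x ω - x) := by
      simp only [alphanj]
      linear_combination ((Gnj P X n j y ω - y) - (Gnj P X n j x ω - x)) * hsq
    linarith
  · rw [Real.rpow_neg hn0.le, ← Real.inv_rpow hn0.le]
    exact Real.rpow_le_rpow (by linarith) hle hμ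

lemma measure_Uv_le_zero (P : Measure Ω) [IsProbabilityMeasure P] {X : ℤ → Ω → Fin d → ℝ}
    (hmeas : ∀ i, Measurable (X i)) (hstat : StrictlyStationary P X) {j : Fin d}
    (hcont : Continuous (margF P X j)) (i : ℤ) : P {ω | Uv P X i ω j ≤ 0} = 0 := by
  have hS : MeasurableSet {f : Fin 1 → Fin d → ℝ | margF P X j (f 0 j) ≤ 0} :=
    measurableSet_le (hcont.measurable.comp
      ((measurable_pi_apply j).comp (measurable_pi_apply 0))) measurable_const
  have h := congrArg (fun ν => ν {f : Fin 1 → Fin d → ℝ | margF P X j (f 0 j) ≤ 0})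
    (hstat 1 (fun _ => 0) i)
  simp only [zero_add] at h
  rw [Measure.map_apply (measurable_pi_lambda _ fun _ => hmeas i) hS,
    Measure.map_apply (measurable_pi_lambda _ fun _ => hmeas 0) hS] at h
  have h0 := measure_Uv_le P (hmeas 0) hcont (left_mem_Icc.2 zero_le_one)
  exact h.trans (((ENNReal.toReal_eq_zero_iff _).1 h0).resolve_right (measure_ne_top _ _))

lemma ae_Gnj_zero (P : Measure Ω) [IsProbabilityMeasure P] {X : ℤ → Ω → Fin d → ℝ}
    (hmeas : ∀ i, Measurable (X i)) (hstat : StrictlyStationary P X) {j : Fin d}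
    (hcont : Continuous (margF P X j)) (n : ℕ) : ∀ᵐ ω ∂P, Gnj P X n j 0 ω = 0 := by
  have : ∀ᵐ ω ∂P, ∀ i : ℤ, ¬ Uv P X i ω j ≤ 0 := ae_all_iff.2 fun i => by
    simpa [ae_iff] using measure_Uv_le_zero P hmeas hstat hcont i
  filter_upwards [this] with ω hω
  simp [Gnj, indic, hω]

/-- Lemma 6.1: under Condition 4.1, `sup_s |G_{nj}(G_{nj}⁻(s)) − s| = o_P(n^{−1/2−μ})`. -/
theorem genInv_composition_negligible
    {Ω : Type*} [MeasurableSpace Ω] {d : ℕ} (hd : 2 ≤ d)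
    (P : Measure Ω) [IsProbabilityMeasure P] (X : ℤ → Ω → Fin d → ℝ)
    (hmeas : ∀ i, Measurable (X i)) (hstat : StrictlyStationary P X)
    (hcont : ∀ j, Continuous (margF P X j))
    (θ₁ : ℝ) (hθ₁ : θ₁ ∈ Set.Ioc (0 : ℝ) (1/2)) (h41 : Condition41 P X θ₁) :
    ∀ j : Fin d, ∀ μ ∈ Set.Ico (0 : ℝ) θ₁,
      oP P (fun n ω =>
          ⨆ s ∈ Set.Icc (0 : ℝ) 1,
            |Gnj P X n j (genInv (fun x => Gnj P X n j x ω) s) ω - s|)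
        (fun n => (n : ℝ) ^ (-(1/2 : ℝ) - μ)) := by
  intro j μ hμ ε hε
  set ν := (μ + θ₁) / 2
  have hμν : μ < ν := by simp only [ν]; linarith [hμ.2]
  have hν : ν ∈ Set.Ioo (0 : ℝ) θ₁ := ⟨hμ.1.trans_lt hμν, by simp only [ν]; linarith [hμ.2]⟩
  have h := h41 ν hν (fun n => (n : ℝ)⁻¹) tendsto_inv_atTop_nhds_zero_nat ε hε
  refine tendsto_of_tendsto_of_tendsto_of_le_of_le' tendsto_const_nhds h
    (Eventually.of_forall fun _ => zero_le) ?_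
  filter_upwards [eventually_gt_atTop 0] with n hn
  apply measure_mono_ae
  filter_upwards [ae_Gnj_zero P hmeas hstat (hcont j) n] with ω h0
  intro (hω : ε * (n : ℝ) ^ (-(1/2 : ℝ) - μ) < _)
  change ε * 1 < |Mn P X n (n : ℝ)⁻¹ ν ω|
  by_contra! hM
  refine absurd hω (not_lt.2 ?_)
  have hn1 : (1 : ℝ) ≤ n := by exact_mod_cast hn
  have hn0 : (0 : ℝ) < n := by linarith
  have hpow : (n : ℝ) ^ (-(1/2 : ℝ) - ν) ≤ (n : ℝ) ^ (-(1/2 : ℝ) - μ) :=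
    Real.rpow_le_rpow_of_exponent_le hn1 (by linarith)
  have hB : Mn P X n (n : ℝ)⁻¹ ν ω * (n : ℝ) ^ (-(1/2 : ℝ) - ν)
      ≤ ε * (n : ℝ) ^ (-(1/2 : ℝ) - μ) :=
    mul_le_mul (by linarith [le_abs_self (Mn P X n (n : ℝ)⁻¹ ν ω)]) hpow (by positivity) hε.le
  have hnn : 0 ≤ ε * (n : ℝ) ^ (-(1/2 : ℝ) - μ) := by positivity
  rw [abs_of_nonneg (Real.iSup_nonneg fun s => Real.iSup_nonneg fun _ => abs_nonneg _)]
  refine Real.iSup_le (fun s => Real.iSup_le (fun hs => ?_) hnn) hnn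
  exact (abs_comp_genInv_sub_le (monotone_Gnj P X n j ω) h0 (Gnj_one P X hn j ω)
    (inv_pos.2 hn0) (fun x y hx hxy hy hle =>
      Gnj_sub_le P (hmeas 0) (hcont j) hn hν.1.le ω hx hxy hy hle) hs).trans hB

end BBV
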